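/- arXiv:0711.4514 — 2 statements merged into one kernel-verified Lean document; each statement's English description precedes it below -/
import Mathlib

section
/- Let I ≥ 1 and let 0 = N^0 < N^1 < N^2 < … be a strictly increasing sequence of integers. For 1 ≤ i ≤ I let (N_i^k)_{k≥0} be nonnegative integers, nondecreasing in k, with N_i^0 = 0 and Σ_{i=1}^I N_i^k = N^k for all k; set r_i^k = (N_i^k − N_i^{k−1}) / (N^k − N^{k−1}). For each n ≥ 1 with N^{k−1} < n ≤ N^k, let ν_i^n be nonnegative integers with Σ_{i=1}^I ν_i^n = n, ν_i^{N^k} = N_i^k, and suppose the interpolation bounds r_i^k − (I−1)/(n − N^{k−1}) < (ν_i^n − N_i^{k−1})/(n − N^{k−1}) < r_i^k + 1/(n − N^{k−1}) hold for all i and all N^{k−1} < n ≤ N^k. If reals q_1,…,q_I satisfy N_i^k / N^k → q_i as k → ∞ for every i, then ν_i^n / n → q_i as n → ∞ for every i. -/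
open Filter

/-- Every integer beyond `N K` lies in a block `(N k, N (k + 1)]` with `K ≤ k`. -/
lemma exists_block_of_lt {N : ℕ → ℕ} (hN : StrictMono N) {K n : ℕ} (hn : N K < n) :
    ∃ k, K ≤ k ∧ N k < n ∧ n ≤ N (k + 1) := by
  have hex : ∃ m, n ≤ N m := ⟨n, hN.le_apply⟩
  have hK : K < Nat.find hex := by
    by_contra! h
    exact absurd (Nat.find_spec hex) (not_le.2 ((hN.monotone h).trans_lt hn))
  obtain ⟨k, hk⟩ := Nat.exists_eq_succ_of_ne_zero (Nat.ne_of_gt (Nat.zero_lt_of_lt hK))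
  refine ⟨k, by lia, ?_, ?_⟩
  · exact not_le.1 (Nat.find_min hex (by lia))
  · simpa [hk] using Nat.find_spec hex

/-- If `|a - q u| ≤ ε u` and `|b - q v| ≤ ε v`, then the same estimate holds at every point of the
segment joining `(u, a)` to `(v, b)`. -/
lemma abs_lineMap_sub_mul_le {a b u v w q ε : ℝ} (huw : u ≤ w) (hwv : w ≤ v) (huv : u < v)
    (ha : |a - q * u| ≤ ε * u) (hb : |b - q * v| ≤ ε * v) :
    |a + (w - u) * ((b - a) / (v - u)) - q * w| ≤ ε * w := by
  have hvu : 0 < v - u := sub_pos.2 huv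
  set t := (w - u) / (v - u) with ht
  have ht0 : 0 ≤ t := div_nonneg (sub_nonneg.2 huw) hvu.le
  have ht1 : 0 ≤ 1 - t := sub_nonneg.2 ((div_le_one hvu).2 (by linarith))
  have hw : w = (1 - t) * u + t * v := by
    rw [ht]
    field_simp
    ring
  have hlin : a + (w - u) * ((b - a) / (v - u)) = (1 - t) * a + t * b := by
    rw [ht]
    field_simp
    ring
  rw [hlin]
  rw [abs_le] at ha hb ⊢
  constructor
  · linear_combination (1 - t) * ha.1 + t * hb.1 + (q - ε) * hw
  · linear_combination (1 - t) * ha.2 + t * hb.2 - (q + ε) * hw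

/-- A sequence staying at bounded distance from the piecewise linear interpolation of the points
`(N k, a k)` satisfies `x n / n → q` as soon as `a k / N k → q`. -/
lemma tendsto_div_of_abs_sub_interpolation_le {N : ℕ → ℕ} (hN : StrictMono N) {a x : ℕ → ℝ}
    {C q : ℝ}
    (hx : ∀ k n : ℕ, N k < n → n ≤ N (k + 1) →
      |x n - (a k + ((n : ℝ) - N k) * ((a (k + 1) - a k) / ((N (k + 1) : ℝ) - N k)))| ≤ C)
    (ha : Tendsto (fun k => a k / (N k : ℝ)) atTop (nhds q)) :
    Tendsto (fun n => x n / (n : ℝ)) atTop (nhds q) := by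
  rw [Metric.tendsto_atTop]
  intro ε hε
  obtain ⟨K, hK⟩ := Metric.tendsto_atTop.1 ha (ε / 2) (half_pos hε)
  have hblock : ∀ k, K + 1 ≤ k → |a k - q * N k| ≤ ε / 2 * N k := by
    intro k hk
    have hpos : (0 : ℝ) < N k := by
      exact_mod_cast (Nat.zero_lt_of_lt hk).trans_le hN.le_apply
    have h := (hK k (by lia)).le
    rwa [Real.dist_eq, div_sub' hpos.ne', abs_div, abs_of_pos hpos, div_le_iff₀ hpos,
      mul_comm (N k : ℝ) q] at h
  obtain ⟨M, hM⟩ := exists_nat_gt (2 * C / ε)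
  refine ⟨max (N (K + 1) + 1) M, fun n hn => ?_⟩
  obtain ⟨k, hk, hkn, hnk⟩ := exists_block_of_lt hN
    (Nat.lt_of_succ_le ((le_max_left _ _).trans hn))
  have hpos : (0 : ℝ) < n := by exact_mod_cast Nat.zero_lt_of_lt hkn
  have hC : C < ε / 2 * n := by
    have hMn : (M : ℝ) ≤ n := by exact_mod_cast (le_max_right _ _).trans hn
    have := (div_lt_iff₀ hε).1 (hM.trans_le hMn)
    linarith
  have hlin := abs_lineMap_sub_mul_le (w := n) (by exact_mod_cast hkn.le) (by exact_mod_cast hnk)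
    (by exact_mod_cast hkn.trans_le hnk) (hblock k hk) (hblock (k + 1) (by lia))
  rw [Real.dist_eq, div_sub' hpos.ne', abs_div, abs_of_pos hpos, div_lt_iff₀ hpos, mul_comm _ q]
  calc |x n - q * n| ≤ _ := abs_sub_le _ _ _
    _ ≤ C + ε / 2 * n := add_le_add (hx k n hkn hnk) hlin
    _ < ε * n := by linarith

/-- Deterministic interpolation lemma: if the single-draw interpolation `ν i n` of a block
allocation `Ni i k` (with block endpoints `N k`) satisfies `∑ i, ν i n = n`,
`ν i (N k) = Ni i k` and, for `N k < n ≤ N (k+1)`, the within-block proportion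
`(ν i n − Ni i k)/(n − N k)` stays within `(r i k − (I−1)/(n − N k), r i k + 1/(n − N k))`
where `r i k = (Ni i (k+1) − Ni i k)/(N (k+1) − N k)`, then the convergence of the block
proportions `Ni i k / N k → q i` transfers to `ν i n / n → q i`. -/
theorem interpolated_proportions_converge
    (I : ℕ) (hI : 1 ≤ I)
    (N : ℕ → ℕ) (hN0 : N 0 = 0) (hNmono : StrictMono N)
    (Ni : Fin I → ℕ → ℕ) (hNi0 : ∀ i, Ni i 0 = 0)
    (hNimono : ∀ i, Monotone (Ni i))
    (hNisum : ∀ k, ∑ i, Ni i k = N k)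
    (ν : Fin I → ℕ → ℕ)
    (hνsum : ∀ n, ∑ i, ν i n = n)
    (hνN : ∀ i k, ν i (N k) = Ni i k)
    (hbounds : ∀ (i : Fin I) (k n : ℕ), N k < n → n ≤ N (k + 1) →
      ((Ni i (k + 1) : ℝ) - Ni i k) / ((N (k + 1) : ℝ) - N k)
          - (I - 1 : ℝ) / ((n : ℝ) - N k)
        < ((ν i n : ℝ) - Ni i k) / ((n : ℝ) - N k) ∧
      ((ν i n : ℝ) - Ni i k) / ((n : ℝ) - N k)
        < ((Ni i (k + 1) : ℝ) - Ni i k) / ((N (k + 1) : ℝ) - N k)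
          + 1 / ((n : ℝ) - N k))
    (q : Fin I → ℝ)
    (hq : ∀ i, Tendsto (fun k => (Ni i k : ℝ) / (N k : ℝ)) atTop (nhds (q i))) :
    ∀ i, Tendsto (fun n => (ν i n : ℝ) / (n : ℝ)) atTop (nhds (q i)) := by
  intro i
  refine tendsto_div_of_abs_sub_interpolation_le hNmono (a := fun k => (Ni i k : ℝ)) (C := I)
    (fun k n hkn hnk => ?_) (hq i)
  have hm : (0 : ℝ) < (n : ℝ) - N k := sub_pos.2 (by exact_mod_cast hkn)
  obtain ⟨hlow, hupp⟩ := hbounds i k n hkn hnk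
  have hI' : (1 : ℝ) ≤ I := by exact_mod_cast hI
  rw [lt_div_iff₀ hm, sub_mul, div_mul_cancel₀ _ hm.ne'] at hlow
  rw [div_lt_iff₀ hm, add_mul, div_mul_cancel₀ _ hm.ne'] at hupp
  rw [abs_le]
  constructor <;> linarith
end

section
/- Let I ≥ 1 and let 0 = N^0 < N^1 < N^2 < … be integers with N^k − N^{k−1} ≥ I for all k ≥ 1 and k / N^k → 0 as k → ∞. Fix an index i, a real q ∈ [0,1], an integer K ≥ 0 and reals (ρ^l)_{l ≥ K} in [0,1] with ρ^l → q as l → ∞. Let (m̃^l)_{l≥1} be nonnegative integers such that for all l > K, ρ^{l−1}(N^l − N^{l−1} − I) − 1 < m̃^l < ρ^{l−1}(N^l − N^{l−1} − I) + 1, and set N_i^k = k + Σ_{l=1}^k m̃^l. Then N_i^k / N^k → q as k → ∞. -/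
open Filter

theorem sum_range_natCast_sub {N : ℕ → ℕ} (hN0 : N 0 = 0) (k : ℕ) :
    ∑ l ∈ Finset.range k, ((N (l + 1) : ℝ) - N l) = N k := by
  rw [Finset.sum_range_sub fun l => (N l : ℝ)]
  simp [hN0]

/-- Partial sums of an eventually bounded sequence grow at most linearly. -/
theorem isBigO_sum_range_natCast {r : ℕ → ℝ} (h : r =O[atTop] fun _ => (1 : ℝ)) :
    (fun k => ∑ l ∈ Finset.range k, r l) =O[atTop] fun k : ℕ => (k : ℝ) := by
  obtain ⟨C, hC⟩ := (Asymptotics.isBigO_nat_atTop_iff (by simp)).1 h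
  refine Asymptotics.IsBigO.of_bound C (Eventually.of_forall fun k => ?_)
  calc ‖∑ l ∈ Finset.range k, r l‖ ≤ ∑ _l ∈ Finset.range k, C :=
        norm_sum_le_of_le _ fun l _ => by simpa using hC l
    _ = C * ‖(k : ℝ)‖ := by simp [mul_comm]

/-- If `x → 0`, sums of the increments of an increasing unbounded sequence weighted by `x` are
negligible with respect to that sequence. -/
theorem isLittleO_sum_range_mul_sub {N : ℕ → ℕ} (hN0 : N 0 = 0) (hN : StrictMono N) {x : ℕ → ℝ}
    (hx : Tendsto x atTop (nhds 0)) :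
    (fun k => ∑ l ∈ Finset.range k, x l * ((N (l + 1) : ℝ) - N l)) =o[atTop]
      fun k => (N k : ℝ) := by
  have hlim : Tendsto (fun k => ∑ l ∈ Finset.range k, ((N (l + 1) : ℝ) - N l)) atTop atTop := by
    simp only [sum_range_natCast_sub hN0]
    exact tendsto_natCast_atTop_atTop.comp hN.tendsto_atTop
  have h : (fun l => x l * ((N (l + 1) : ℝ) - N l)) =o[atTop]
      fun l => (N (l + 1) : ℝ) - N l := by
    simpa using ((Asymptotics.isLittleO_one_iff ℝ).2 hx).mul_isBigO
      (Asymptotics.isBigO_refl (fun l => (N (l + 1) : ℝ) - N l) atTop)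
  simpa only [sum_range_natCast_sub hN0] using h.sum_range
    (fun l => sub_nonneg.2 (Nat.cast_le.2 (hN.monotone l.le_succ))) hlim

/-- Deterministic core of the proof that allocation rule (a) is asymptotically optimal:
with block endpoints `0 = N⁰ < N¹ < …` satisfying `N^k − N^{k−1} ≥ I` and `k/N^k → 0`, if at
each step `l > K` the number `m̃ l` of extra draws in the stratum is within distance 1 of
`ρ^{l−1} (N^l − N^{l−1} − I)` where `ρ^l ∈ [0,1]` converges to `q`, then the realized
proportion `N_i^k / N^k = (k + ∑_{l=1}^k m̃ l)/N^k` converges to `q`. -/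
theorem allocation_rule_a_proportion_converges
    (I : ℕ) (hI : 1 ≤ I)
    (N : ℕ → ℕ) (hN0 : N 0 = 0) (hNmono : StrictMono N)
    (hNstep : ∀ k : ℕ, I ≤ N (k + 1) - N k)
    (hNk : Tendsto (fun k : ℕ => (k : ℝ) / (N k : ℝ)) atTop (nhds 0))
    (i : ℕ) (q : ℝ) (hq0 : 0 ≤ q) (hq1 : q ≤ 1)
    (K : ℕ) (ρ : ℕ → ℝ) (hρmem : ∀ l ≥ K, ρ l ∈ Set.Icc (0 : ℝ) 1)
    (hρ : Tendsto ρ atTop (nhds q))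
    (mt : ℕ → ℕ)
    (hmt : ∀ l > K,
      ρ (l - 1) * ((N l : ℝ) - N (l - 1) - I) - 1 < (mt l : ℝ) ∧
      (mt l : ℝ) < ρ (l - 1) * ((N l : ℝ) - N (l - 1) - I) + 1) :
    Tendsto (fun k : ℕ => ((k + ∑ l ∈ Finset.Icc 1 k, mt l : ℕ) : ℝ) / (N k : ℝ))
      atTop (nhds q) := by
  set r : ℕ → ℝ := fun l => 1 + mt (l + 1) - ρ l * ((N (l + 1) : ℝ) - N l) with hr
  have hrO : r =O[atTop] fun _ => (1 : ℝ) := by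
    refine Asymptotics.IsBigO.of_bound (I + 2) ?_
    filter_upwards [eventually_ge_atTop K] with l hl
    obtain ⟨h0, h1⟩ := hρmem l hl
    obtain ⟨h2, h3⟩ := hmt (l + 1) (Nat.lt_succ_of_le hl)
    rw [Nat.add_sub_cancel] at h2 h3
    have hI0 : (0 : ℝ) ≤ I := I.cast_nonneg
    have h4 : 0 ≤ ρ l * I := mul_nonneg h0 hI0
    have h5 : ρ l * I ≤ I := mul_le_of_le_one_left hI0 h1
    rw [norm_one, mul_one, Real.norm_eq_abs, abs_le]
    constructor <;> simp only [hr] <;> linarith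
  have hpos : ∀ᶠ k in atTop, (N k : ℝ) ≠ 0 := by
    filter_upwards [eventually_gt_atTop 0] with k hk
    exact Nat.cast_ne_zero.2 (hN0 ▸ hNmono hk).ne'
  have hkN : (fun k : ℕ => (k : ℝ)) =o[atTop] fun k => (N k : ℝ) :=
    (Asymptotics.isLittleO_iff_tendsto' (hpos.mono fun _ h h0 => absurd h0 h)).2 hNk
  have hx : Tendsto (fun l => ρ l - q) atTop (nhds 0) := by simpa using hρ.sub_const q
  have herr := ((isLittleO_sum_range_mul_sub hN0 hNmono hx).add
    ((isBigO_sum_range_natCast hrO).trans_isLittleO hkN)).tendsto_div_nhds_zero.const_add q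
  rw [add_zero] at herr
  refine herr.congr' ?_
  filter_upwards [hpos] with k hk
  have hIcc : ∑ l ∈ Finset.Icc 1 k, mt l = ∑ l ∈ Finset.range k, mt (l + 1) := by
    rw [Finset.range_eq_Ico, Finset.sum_Ico_add' mt 0 k 1]
    rfl
  have key : ∑ l ∈ Finset.range k, (ρ l - q) * ((N (l + 1) : ℝ) - N l) +
      ∑ l ∈ Finset.range k, r l =
      ((k + ∑ l ∈ Finset.Icc 1 k, mt l : ℕ) : ℝ) - q * N k := by
    rw [hIcc, ← sum_range_natCast_sub hN0 k, Finset.mul_sum, ← Finset.sum_add_distrib]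
    have hk1 : (k : ℝ) = ∑ _l ∈ Finset.range k, (1 : ℝ) := by simp
    rw [Nat.cast_add, Nat.cast_sum, hk1, ← Finset.sum_add_distrib, ← Finset.sum_sub_distrib]
    exact Finset.sum_congr rfl fun l _ => by simp only [hr]; ring
  rw [key, sub_div, mul_div_cancel_right₀ _ hk]
  ring
end
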